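/- arXiv:1110.0297 — 2 statements merged into one kernel-verified Lean document; each statement's English description precedes it below -/
import Mathlib

section
/- Let p₀, p₁ : ℝⁿ → [1,∞) be measurable a.e. finite exponents, θ ∈ [0,1], and define p_θ by 1/p_θ(x) = θ/p₀(x) + (1−θ)/p₁(x). If a linear operator A is bounded on L^{p₀(·)}(ℝⁿ) and on L^{p₁(·)}(ℝⁿ), then A is bounded on L^{p_θ(·)}(ℝⁿ) with ‖A‖_{B(L^{p_θ(·)})} ≤ 4 ‖A‖_{B(L^{p₀(·)})}^θ ‖A‖_{B(L^{p₁(·)})}^{1−θ}. -/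
open MeasureTheory ENNReal Filter Topology
noncomputable section
abbrev Vn (n : ℕ) := EuclideanSpace ℝ (Fin n)

/-- The modular `I_{p(·)}(f) = ∫ |f(x)|^{p(x)} dx`. -/
def modular {n : ℕ} {E : Type*} [NormedAddCommGroup E] (p : Vn n → ℝ) (f : Vn n → E) : ℝ≥0∞ :=
  ∫⁻ x, ENNReal.ofReal (‖f x‖ ^ p x)

/-- Membership in the variable Lebesgue space `L^{p(·)}`. -/
def memVL {n : ℕ} {E : Type*} [NormedAddCommGroup E] [NormedSpace ℝ E]
    (p : Vn n → ℝ) (f : Vn n → E) : Prop :=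
  AEStronglyMeasurable f volume ∧ ∃ l : ℝ, 0 < l ∧ modular p (fun x => l⁻¹ • f x) < ⊤

/-- The Luxemburg norm on `L^{p(·)}` (valued in `ℝ≥0∞`, `⊤` if no admissible `λ`). -/
def VLnorm {n : ℕ} {E : Type*} [NormedAddCommGroup E] [NormedSpace ℝ E]
    (p : Vn n → ℝ) (f : Vn n → E) : ℝ≥0∞ :=
  ⨅ (l : ℝ) (_ : 0 < l) (_ : modular p (fun x => l⁻¹ • f x) ≤ 1), ENNReal.ofReal l

section Luxemburg

variable {n : ℕ} {E F : Type*} [NormedAddCommGroup E] [NormedAddCommGroup F]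

lemma modular_congr_exponent {p q : Vn n → ℝ} (h : p =ᵐ[volume] q) (f : Vn n → E) :
    modular p f = modular q f := by
  refine lintegral_congr_ae ?_
  filter_upwards [h] with x hx
  simp only [hx]

lemma modular_mono {p : Vn n → ℝ} (hp : ∀ x, 1 ≤ p x) {f : Vn n → E} {g : Vn n → F}
    (h : ∀ x, ‖f x‖ ≤ ‖g x‖) : modular p f ≤ modular p g := by
  refine lintegral_mono fun x => ENNReal.ofReal_le_ofReal ?_
  exact Real.rpow_le_rpow (norm_nonneg _) (h x) (zero_le_one.trans (hp x))

variable [NormedSpace ℝ E]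

lemma memVL_congr_exponent {p q : Vn n → ℝ} (h : p =ᵐ[volume] q) (f : Vn n → E) :
    memVL p f ↔ memVL q f := by
  simp only [memVL, modular_congr_exponent h]

lemma VLnorm_congr_exponent {p q : Vn n → ℝ} (h : p =ᵐ[volume] q) (f : Vn n → E) :
    VLnorm p f = VLnorm q f := by
  simp only [VLnorm, modular_congr_exponent h]

lemma VLnorm_le_ofReal {p : Vn n → ℝ} {f : Vn n → E} {l : ℝ} (hl : 0 < l)
    (h : modular p (fun x => l⁻¹ • f x) ≤ 1) : VLnorm p f ≤ ENNReal.ofReal l :=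
  iInf_le_of_le l (iInf_le_of_le hl (iInf_le_of_le h le_rfl))

lemma modular_inv_smul_le_one_of_VLnorm_lt {p : Vn n → ℝ} (hp : ∀ x, 1 ≤ p x)
    {f : Vn n → E} {l : ℝ} (h : VLnorm p f < ENNReal.ofReal l) :
    modular p (fun x => l⁻¹ • f x) ≤ 1 := by
  simp only [VLnorm, iInf_lt_iff] at h
  obtain ⟨l', hl', hm, hlt⟩ := h
  have hll : l' < l := (ENNReal.ofReal_lt_ofReal_iff_of_nonneg hl'.le).1 hlt
  refine (modular_mono hp fun x => ?_).trans hm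
  have hl : 0 < l := hl'.trans hll
  rw [norm_smul, norm_smul, Real.norm_of_nonneg (by positivity),
    Real.norm_of_nonneg (by positivity)]
  gcongr

lemma exists_modular_inv_smul_le_one {p : Vn n → ℝ} (hp : ∀ x, 1 ≤ p x)
    {f : Vn n → E} (hf : memVL p f) :
    ∃ l : ℝ, 0 < l ∧ modular p (fun x => l⁻¹ • f x) ≤ 1 := by
  obtain ⟨-, l, hl, hfin⟩ := hf
  set m := modular p (fun x => l⁻¹ • f x) with hm
  set c : ℝ := 1 + m.toReal with hc
  have hc1 : 1 ≤ c := by simp [hc]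
  have hc0 : 0 < c := by linarith
  refine ⟨c * l, by positivity, ?_⟩
  have key : modular p (fun x => (c * l)⁻¹ • f x) ≤ ENNReal.ofReal c⁻¹ * m := by
    rw [hm, modular, modular, ← lintegral_const_mul' _ _ ENNReal.ofReal_ne_top]
    refine lintegral_mono fun x => ?_
    rw [← ENNReal.ofReal_mul (by positivity)]
    refine ENNReal.ofReal_le_ofReal ?_
    rw [mul_inv, mul_smul, norm_smul, Real.norm_of_nonneg (by positivity),
      Real.mul_rpow (by positivity) (norm_nonneg _)]
    gcongr
    calc c⁻¹ ^ p x ≤ c⁻¹ ^ (1 : ℝ) :=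
          Real.rpow_le_rpow_of_exponent_ge (by positivity) (inv_le_one_of_one_le₀ hc1) (hp x)
      _ = c⁻¹ := Real.rpow_one _
  refine key.trans ?_
  rw [← ENNReal.ofReal_toReal hfin.ne, ← ENNReal.ofReal_mul (by positivity), ENNReal.ofReal_le_one,
    inv_mul_le_one₀ hc0, hc]
  linarith

end Luxemburg

lemma le_rpow_add_rpow_mul {t w p : ℝ} (ht : 0 ≤ t) (hw : 0 < w) (hp : 1 ≤ p) :
    t * w ^ (1 - 1 / p) ≤ t ^ p + w := by
  have hp0 : 0 < p := by linarith
  have he : 0 ≤ 1 - 1 / p := by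
    rw [sub_nonneg, div_le_one hp0]; exact hp
  rcases le_total (t ^ p) w with h | h
  · have h1 : t ≤ w ^ (1 / p) := by
      calc t = (t ^ p) ^ (1 / p) := by
            rw [← Real.rpow_mul ht, mul_one_div_cancel hp0.ne', Real.rpow_one]
        _ ≤ w ^ (1 / p) := Real.rpow_le_rpow (by positivity) h (by positivity)
    calc t * w ^ (1 - 1 / p) ≤ w ^ (1 / p) * w ^ (1 - 1 / p) := by gcongr
      _ = w := by rw [← Real.rpow_add hw]; simp
      _ ≤ t ^ p + w := by linarith [Real.rpow_nonneg ht p]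
  · have ht' : 0 < t := by
      rcases ht.eq_or_lt with rfl | h'
      · rw [Real.zero_rpow hp0.ne'] at h; linarith
      · exact h'
    calc t * w ^ (1 - 1 / p) ≤ t * (t ^ p) ^ (1 - 1 / p) := by gcongr
      _ = t ^ p := by
        rw [← Real.rpow_mul ht, mul_sub, mul_one_div_cancel hp0.ne', mul_one]
        nth_rewrite 1 [← Real.rpow_one t]
        rw [← Real.rpow_add ht']; congr 1; ring
      _ ≤ t ^ p + w := by linarith

section ExponentialIntegral

variable {α : Type*} [MeasurableSpace α] {ν : Measure α} {v : α → ℂ} {D : α → ℝ} {L : ℝ}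

lemma norm_cexp_mul_ofReal_le {z : ℂ} {d : ℝ} (hd : |d| ≤ L) :
    ‖Complex.exp (z * d)‖ ≤ Real.exp (|z.re| * L) := by
  rw [Complex.norm_exp, Complex.re_mul_ofReal]
  refine Real.exp_le_exp.2 ((le_abs_self _).trans ?_)
  rw [abs_mul]
  gcongr

lemma aestronglyMeasurable_cexp_mul (hD : AEMeasurable D ν) (z : ℂ) :
    AEStronglyMeasurable (fun x => Complex.exp (z * D x)) ν :=
  (Complex.measurable_exp.comp_aemeasurable
    ((Complex.measurable_ofReal.comp_aemeasurable hD).const_mul z)).aestronglyMeasurable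

lemma integrable_mul_cexp (hv : Integrable v ν) (hD : AEMeasurable D ν)
    (hL : ∀ᵐ x ∂ν, |D x| ≤ L) (z : ℂ) :
    Integrable (fun x => v x * Complex.exp (z * D x)) ν :=
  hv.mul_bdd (aestronglyMeasurable_cexp_mul hD z)
    (hL.mono fun _ hx => norm_cexp_mul_ofReal_le hx)

lemma differentiable_integral_mul_cexp (hv : Integrable v ν) (hD : AEMeasurable D ν)
    (hL : ∀ᵐ x ∂ν, |D x| ≤ L) :
    Differentiable ℂ (fun z : ℂ => ∫ x, v x * Complex.exp (z * D x) ∂ν) := by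
  intro z₀
  refine (hasDerivAt_integral_of_dominated_loc_of_deriv_le (s := Metric.ball z₀ 1)
    (F' := fun z x => v x * (Complex.exp (z * D x) * D x))
    (bound := fun x => ‖v x‖ * (Real.exp ((‖z₀‖ + 1) * L) * L))
    (Metric.ball_mem_nhds _ one_pos) ?_ (integrable_mul_cexp hv hD hL z₀)
    ?_ ?_ ?_ ?_).2.differentiableAt
  · exact Eventually.of_forall fun z => (integrable_mul_cexp hv hD hL z).aestronglyMeasurable
  · exact hv.aestronglyMeasurable.mul ((aestronglyMeasurable_cexp_mul hD z₀).mul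
      (Complex.measurable_ofReal.comp_aemeasurable hD).aestronglyMeasurable)
  · filter_upwards [hL] with x hx z hz
    have hL0 : 0 ≤ L := (abs_nonneg _).trans hx
    have hz' : |z.re| ≤ ‖z₀‖ + 1 := by
      refine (Complex.abs_re_le_norm z).trans ?_
      have := norm_sub_norm_le z z₀
      rw [Metric.mem_ball, dist_eq_norm] at hz
      linarith
    rw [norm_mul, norm_mul, Complex.norm_real, Real.norm_eq_abs]
    gcongr
    refine (norm_cexp_mul_ofReal_le hx).trans ?_
    gcongr
  · exact hv.norm.mul_const _
  · refine Eventually.of_forall fun x z _ => ?_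
    have h1 : HasDerivAt (fun z : ℂ => z * (D x : ℂ)) (D x) z := hasDerivAt_mul_const _
    exact h1.cexp.const_mul (v x)

lemma norm_integral_mul_cexp_le (hv : Integrable v ν) (hL : ∀ᵐ x ∂ν, |D x| ≤ L) (z : ℂ) :
    ‖∫ x, v x * Complex.exp (z * D x) ∂ν‖ ≤ (∫ x, ‖v x‖ ∂ν) * Real.exp (|z.re| * L) := by
  rw [← integral_mul_const]
  refine norm_integral_le_of_norm_le (hv.norm.mul_const _) (hL.mono fun x hx => ?_)
  rw [norm_mul]
  gcongr
  exact norm_cexp_mul_ofReal_le hx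

/-- The three lines inequality for a finite sum of integrals depending exponentially on `z`. -/
lemma norm_sum_cexp_mul_integral_le {ι : Type*} (s : Finset ι) (c : ι → ℝ) {v : ι → α → ℂ}
    (hv : ∀ k ∈ s, Integrable (v k) ν) (hD : AEMeasurable D ν) (hL : ∀ᵐ x ∂ν, |D x| ≤ L)
    {a b θ : ℝ} (hθ : θ ∈ Set.Icc (0 : ℝ) 1)
    (ha : ∀ z : ℂ, z.re = 0 →
      ‖∫ x, (∑ k ∈ s, Complex.exp (z * c k) * v k x) * Complex.exp (z * D x) ∂ν‖ ≤ a)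
    (hb : ∀ z : ℂ, z.re = 1 →
      ‖∫ x, (∑ k ∈ s, Complex.exp (z * c k) * v k x) * Complex.exp (z * D x) ∂ν‖ ≤ b) :
    ‖∫ x, (∑ k ∈ s, Complex.exp (θ * c k) * v k x) * Complex.exp (θ * D x) ∂ν‖ ≤
      a ^ (1 - θ) * b ^ θ := by
  set Φ : ℂ → ℂ := fun z =>
    ∫ x, (∑ k ∈ s, Complex.exp (z * c k) * v k x) * Complex.exp (z * D x) ∂ν with hΦ
  have hΦ' : ∀ z, Φ z =
      ∑ k ∈ s, Complex.exp (z * c k) * ∫ x, v k x * Complex.exp (z * D x) ∂ν := by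
    intro z
    simp only [hΦ, Finset.sum_mul, mul_assoc]
    rw [integral_finsetSum]
    · simp only [integral_const_mul]
    · exact fun k hk => (integrable_mul_cexp (hv k hk) hD hL z).const_mul _
  have hdiff : Differentiable ℂ Φ := by
    rw [funext hΦ']
    refine Differentiable.fun_sum fun k hk => ?_
    exact ((differentiable_id.mul_const (c k : ℂ)).cexp).mul
      (differentiable_integral_mul_cexp (hv k hk) hD hL)
  have hbdd : BddAbove ((norm ∘ Φ) '' Complex.HadamardThreeLines.verticalClosedStrip 0 1) := by
    refine ⟨∑ k ∈ s, Real.exp |c k| * ((∫ x, ‖v k x‖ ∂ν) * Real.exp |L|), ?_⟩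
    rintro _ ⟨z, hz, rfl⟩
    have hre : |z.re| ≤ 1 := by
      rw [abs_le]; constructor <;> linarith [hz.1, hz.2]
    simp only [Function.comp_apply]
    rw [hΦ']
    refine (norm_sum_le _ _).trans (Finset.sum_le_sum fun k hk => ?_)
    rw [norm_mul]
    gcongr
    · refine (norm_cexp_mul_ofReal_le le_rfl).trans (Real.exp_le_exp.2 ?_)
      nlinarith [abs_nonneg (c k)]
    · refine (norm_integral_mul_cexp_le (hv k hk) hL z).trans ?_
      gcongr
      nlinarith [abs_nonneg z.re, le_abs_self L, abs_nonneg L]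
  have := Complex.HadamardThreeLines.norm_le_interp_of_mem_verticalClosedStrip₀₁' Φ (z := (θ : ℂ))
    (a := a) (b := b) (by simpa [Complex.HadamardThreeLines.verticalClosedStrip] using hθ)
    hdiff.diffContOnCl hbdd (fun z hz => ha z hz) (fun z hz => hb z hz)
  simpa using this

end ExponentialIntegral

section Duality

variable {n : ℕ} {p : Vn n → ℝ} {H g : Vn n → ℂ} {w : Vn n → ℝ} {S : Set (Vn n)} {M : ℝ}

lemma setLIntegral_ofReal_ne_top (hS : MeasurableSet S) (hfin : volume S ≠ ⊤)
    (hw : ∀ x ∈ S, 0 < w x) {L : ℝ} (hL : ∀ x ∈ S, |Real.log (w x)| ≤ L) :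
    ∫⁻ x in S, ENNReal.ofReal (w x) ≠ ⊤ := by
  refine ne_top_of_le_ne_top (b := ENNReal.ofReal (Real.exp L) * volume S) (by finiteness) ?_
  rw [← setLIntegral_const]
  refine setLIntegral_mono' hS fun x hx => ENNReal.ofReal_le_ofReal ?_
  rw [← Real.exp_log (hw x hx)]
  exact Real.exp_le_exp.2 ((le_abs_self _).trans (hL x hx))

lemma setLIntegral_enorm_mul_le (hp : ∀ x, 1 ≤ p x) (hM : 0 < M)
    (hH : modular p (fun x => M⁻¹ • H x) ≤ 1) (hS : MeasurableSet S) (hwm : Measurable w)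
    (hw : ∀ x ∈ S, 0 < w x) (hg : ∀ x ∈ S, ‖g x‖ ≤ w x ^ (1 - 1 / p x)) :
    ∫⁻ x in S, ‖H x * g x‖ₑ ≤ ENNReal.ofReal M * (1 + ∫⁻ x in S, ENNReal.ofReal (w x)) := by
  calc ∫⁻ x in S, ‖H x * g x‖ₑ
      ≤ ∫⁻ x in S, ENNReal.ofReal M *
          (ENNReal.ofReal (‖M⁻¹ • H x‖ ^ p x) + ENNReal.ofReal (w x)) := by
        refine setLIntegral_mono' hS fun x hx => ?_
        have hwx := hw x hx
        rw [← ENNReal.ofReal_add (by positivity) hwx.le, ← ENNReal.ofReal_mul hM.le,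
          ← ofReal_norm]
        refine ENNReal.ofReal_le_ofReal ?_
        calc ‖H x * g x‖ = M * (‖M⁻¹ • H x‖ * ‖g x‖) := by
              rw [norm_mul, norm_smul, Real.norm_of_nonneg (by positivity)]
              field_simp
          _ ≤ M * (‖M⁻¹ • H x‖ * w x ^ (1 - 1 / p x)) := by
              gcongr
              exact hg x hx
          _ ≤ _ := by
              gcongr
              exact le_rpow_add_rpow_mul (norm_nonneg _) hwx (hp x)
    _ = ENNReal.ofReal M * ((∫⁻ x in S, ENNReal.ofReal (‖M⁻¹ • H x‖ ^ p x)) +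
          ∫⁻ x in S, ENNReal.ofReal (w x)) := by
        rw [lintegral_const_mul' _ _ ENNReal.ofReal_ne_top,
          lintegral_add_right _ (by fun_prop)]
    _ ≤ _ := by
        gcongr
        exact (setLIntegral_le_lintegral _ _).trans hH

lemma norm_setIntegral_mul_le (hp : ∀ x, 1 ≤ p x) (hM : 0 < M)
    (hH : modular p (fun x => M⁻¹ • H x) ≤ 1) (hS : MeasurableSet S) (hwm : Measurable w)
    (hw : ∀ x ∈ S, 0 < w x) (hg : ∀ x ∈ S, ‖g x‖ ≤ w x ^ (1 - 1 / p x))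
    (hW : ∫⁻ x in S, ENNReal.ofReal (w x) ≠ ⊤) :
    ‖∫ x in S, H x * g x‖ ≤ M * (1 + (∫⁻ x in S, ENNReal.ofReal (w x)).toReal) := by
  have h := (enorm_integral_le_lintegral_enorm (μ := volume.restrict S) fun x => H x * g x).trans
    (setLIntegral_enorm_mul_le hp hM hH hS hwm hw hg)
  rw [← ofReal_norm] at h
  have h1 := ENNReal.toReal_mono (by finiteness) h
  rwa [ENNReal.toReal_ofReal (norm_nonneg _), ENNReal.toReal_mul, ENNReal.toReal_ofReal hM.le,
    ENNReal.toReal_add (by simp) hW, ENNReal.toReal_one] at h1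

lemma setLIntegral_enorm_le (hp : ∀ x, 1 ≤ p x) (hM : 0 < M)
    (hH : modular p (fun x => M⁻¹ • H x) ≤ 1) (hS : MeasurableSet S) :
    ∫⁻ x in S, ‖H x‖ₑ ≤ ENNReal.ofReal M * (1 + volume S) := by
  simpa using setLIntegral_enorm_mul_le (g := fun _ => 1) (w := fun _ => 1) hp hM hH hS
    measurable_const (fun _ _ => one_pos) (fun _ _ => by simp)

lemma memVL.integrableOn (hp : ∀ x, 1 ≤ p x) (hH : memVL p H) (hS : MeasurableSet S)
    (hfin : volume S ≠ ⊤) : IntegrableOn H S := by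
  obtain ⟨l, hl, hm⟩ := exists_modular_inv_smul_le_one hp hH
  refine ⟨hH.1.restrict, (setLIntegral_enorm_le hp hl hm hS).trans_lt ?_⟩
  finiteness

lemma norm_setIntegral_mul_le_of_norm_le (hp : ∀ x, 1 ≤ p x) (hM : 0 < M)
    (hH : modular p (fun x => M⁻¹ • H x) ≤ 1) (hS : MeasurableSet S) (hfin : volume S ≠ ⊤)
    {G : ℝ} (hG : 0 ≤ G) (hg : ∀ x ∈ S, ‖g x‖ ≤ G) :
    ‖∫ x in S, H x * g x‖ ≤ M * (1 + (volume S).toReal) * G := by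
  have h : ‖∫ x in S, H x * g x‖ₑ ≤
      ENNReal.ofReal M * (1 + volume S) * ENNReal.ofReal G := by
    refine (enorm_integral_le_lintegral_enorm _).trans ?_
    calc ∫⁻ x in S, ‖H x * g x‖ₑ ≤ ∫⁻ x in S, ‖H x‖ₑ * ENNReal.ofReal G := by
          refine setLIntegral_mono' hS fun x hx => ?_
          rw [enorm_mul, ← ofReal_norm (g x)]
          gcongr
          exact hg x hx
      _ = (∫⁻ x in S, ‖H x‖ₑ) * ENNReal.ofReal G :=
          lintegral_mul_const' _ _ ENNReal.ofReal_ne_top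
      _ ≤ _ := by
          gcongr
          exact setLIntegral_enorm_le hp hM hH hS
  rw [← ofReal_norm] at h
  have h1 := ENNReal.toReal_mono (by finiteness) h
  rwa [ENNReal.toReal_ofReal (norm_nonneg _), ENNReal.toReal_mul, ENNReal.toReal_mul,
    ENNReal.toReal_ofReal hM.le, ENNReal.toReal_ofReal hG,
    ENNReal.toReal_add (by simp) hfin, ENNReal.toReal_one] at h1

/-- The three lines inequality for the pairing of an exponential sum with the analytic family of
dual functions attached to a weight `w`. -/
lemma norm_setIntegral_interp_le {p₀ p₁ : Vn n → ℝ} (h₀ : Measurable p₀) (h₁ : Measurable p₁)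
    (hp₀ : ∀ x, 1 ≤ p₀ x) (hp₁ : ∀ x, 1 ≤ p₁ x) {θ : ℝ} (hθ : θ ∈ Set.Icc (0 : ℝ) 1)
    (hS : MeasurableSet S) (hfin : volume S ≠ ⊤) (hwm : Measurable w) (hw : ∀ x ∈ S, 0 < w x)
    {L : ℝ} (hL : ∀ x ∈ S, |Real.log (w x)| ≤ L) {τ : Vn n → ℂ} (hτm : Measurable τ)
    (hτ : ∀ x, ‖τ x‖ ≤ 1) {ι : Type*} (s : Finset ι) (c : ι → ℝ) {h : ι → Vn n → ℂ}
    (hh : ∀ k ∈ s, IntegrableOn (h k) S) {M₀ M₁ : ℝ} (hM₀ : 0 < M₀) (hM₁ : 0 < M₁)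
    (H₀ : ∀ z : ℂ, z.re = 1 →
      modular p₀ (fun x => M₀⁻¹ • ∑ k ∈ s, Complex.exp (z * c k) * h k x) ≤ 1)
    (H₁ : ∀ z : ℂ, z.re = 0 →
      modular p₁ (fun x => M₁⁻¹ • ∑ k ∈ s, Complex.exp (z * c k) * h k x) ≤ 1) :
    ‖∫ x in S, (∑ k ∈ s, Complex.exp (θ * c k) * h k x) *
        (τ x * ((w x ^ (1 - (θ / p₀ x + (1 - θ) / p₁ x)) : ℝ) : ℂ))‖ ≤
      M₀ ^ θ * M₁ ^ (1 - θ) * (1 + (∫⁻ x in S, ENNReal.ofReal (w x)).toReal) := by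
  have hL0 : S.Nonempty → 0 ≤ L := fun ⟨x, hx⟩ => (abs_nonneg _).trans (hL x hx)
  have hinv : ∀ {p : ℝ}, 1 ≤ p → 0 ≤ 1 / p ∧ 1 / p ≤ 1 := fun {p} hp =>
    ⟨by positivity, by rw [div_le_one (by linarith)]; exact hp⟩
  set W := ∫⁻ x in S, ENNReal.ofReal (w x) with hWdef
  have hW : W ≠ ⊤ := setLIntegral_ofReal_ne_top hS hfin hw hL
  set B : Vn n → ℝ := fun x => Real.log (w x) * (1 - 1 / p₁ x) with hB
  set D : Vn n → ℝ := fun x => Real.log (w x) * (1 / p₁ x - 1 / p₀ x) with hD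
  have hDm : Measurable D := by fun_prop
  have hBm : Measurable B := by fun_prop
  have hDL : ∀ x ∈ S, |D x| ≤ L := by
    intro x hx
    have i0 := hinv (hp₀ x)
    have i1 := hinv (hp₁ x)
    calc |D x| = |Real.log (w x)| * |1 / p₁ x - 1 / p₀ x| := abs_mul _ _
      _ ≤ L * 1 := by
        refine mul_le_mul (hL x hx) ?_ (abs_nonneg _) (hL0 ⟨x, hx⟩)
        rw [abs_le]; constructor <;> linarith
      _ = L := mul_one L
  have hBL : ∀ x ∈ S, |B x| ≤ L := by
    intro x hx
    have i1 := hinv (hp₁ x)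
    calc |B x| = |Real.log (w x)| * |1 - 1 / p₁ x| := abs_mul _ _
      _ ≤ L * 1 := by
        refine mul_le_mul (hL x hx) ?_ (abs_nonneg _) (hL0 ⟨x, hx⟩)
        rw [abs_le]; constructor <;> linarith
      _ = L := mul_one L
  set v : ι → Vn n → ℂ := fun k x => h k x * (τ x * Complex.exp ((1 : ℂ) * B x)) with hv
  have hvint : ∀ k ∈ s, IntegrableOn (v k) S := by
    intro k hk
    refine (hh k hk).mul_bdd (c := 1 * Real.exp (|(1 : ℂ).re| * L))
      (hτm.aestronglyMeasurable.mul (aestronglyMeasurable_cexp_mul hBm.aemeasurable 1)) ?_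
    filter_upwards [ae_restrict_mem hS] with x hx
    rw [norm_mul]
    exact mul_le_mul (hτ x) (norm_cexp_mul_ofReal_le (hBL x hx)) (norm_nonneg _) zero_le_one
  have hrw : ∀ z x, (∑ k ∈ s, Complex.exp (z * c k) * v k x) * Complex.exp (z * D x) =
      (∑ k ∈ s, Complex.exp (z * c k) * h k x) *
        (τ x * (Complex.exp ((1 : ℂ) * B x) * Complex.exp (z * D x))) := by
    intro z x
    simp only [hv, Finset.sum_mul]
    refine Finset.sum_congr rfl fun k _ => by ring
  have hnorm : ∀ z x, ‖τ x * (Complex.exp ((1 : ℂ) * B x) * Complex.exp (z * D x))‖ ≤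
      Real.exp (B x + z.re * D x) := by
    intro z x
    rw [norm_mul, ← Complex.exp_add, Complex.norm_exp]
    simpa using mul_le_mul_of_nonneg_right (hτ x) (Real.exp_pos (B x + z.re * D x)).le
  have key := norm_sum_cexp_mul_integral_le (ν := volume.restrict S) s c (v := v) hvint
    hDm.aemeasurable ((ae_restrict_mem hS).mono hDL) hθ
    (a := M₁ * (1 + W.toReal)) (b := M₀ * (1 + W.toReal)) ?_ ?_
  · have hW1 : 0 < 1 + W.toReal := by positivity
    calc _ = ‖∫ x in S, (∑ k ∈ s, Complex.exp (θ * c k) * v k x) *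
          Complex.exp (θ * D x)‖ := by
          congr 1
          refine setIntegral_congr_fun hS fun x hx => ?_
          simp only [hrw]
          congr 2
          rw [← Complex.exp_add, Real.rpow_def_of_pos (hw x hx), Complex.ofReal_exp]
          congr 1
          simp only [hB, hD]
          push_cast
          ring
      _ ≤ _ := key
      _ = M₀ ^ θ * M₁ ^ (1 - θ) * ((1 + W.toReal) ^ (1 - θ) * (1 + W.toReal) ^ θ) := by
          rw [Real.mul_rpow hM₁.le hW1.le, Real.mul_rpow hM₀.le hW1.le]
          ring
      _ = _ := by
          rw [← Real.rpow_add hW1]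
          simp
  · intro z hz
    simp only [hrw]
    refine norm_setIntegral_mul_le hp₁ hM₁ (H₁ z hz) hS hwm hw (fun x hx => ?_) hW
    refine (hnorm z x).trans_eq ?_
    rw [Real.rpow_def_of_pos (hw x hx), hz]
    congr 1
    simp [hB]
  · intro z hz
    simp only [hrw]
    refine norm_setIntegral_mul_le hp₀ hM₀ (H₀ z hz) hS hwm hw (fun x hx => ?_) hW
    refine (hnorm z x).trans_eq ?_
    rw [Real.rpow_def_of_pos (hw x hx), hz]
    congr 1
    simp only [hB, hD]
    ring

end Duality

section Decomposition

variable {n : ℕ}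

lemma modular_le_of_norm_le_exp {p q : Vn n → ℝ} (hp : ∀ x, 1 ≤ p x) {f g : Vn n → ℂ}
    (h0 : ∀ x, f x = 0 → g x = 0)
    (h : ∀ x, ‖g x‖ ≤ Real.exp (Real.log ‖f x‖ * (q x / p x))) :
    modular p g ≤ modular q f := by
  refine lintegral_mono fun x => ENNReal.ofReal_le_ofReal ?_
  have hpx : 0 < p x := zero_lt_one.trans_le (hp x)
  by_cases hf : f x = 0
  · rw [h0 x hf, norm_zero, Real.zero_rpow hpx.ne']
    positivity
  · calc ‖g x‖ ^ p x ≤ Real.exp (Real.log ‖f x‖ * (q x / p x)) ^ p x := by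
          gcongr
          exact h x
      _ = ‖f x‖ ^ q x := by
          rw [← Real.exp_mul, Real.rpow_def_of_pos (norm_pos_iff.2 hf)]
          congr 1
          field_simp

/-- Approximation, up to small errors in `L^{p₀(·)}` and `L^{p₁(·)}`, of an element of the unit
ball of the intermediate space by the value at `θ` of a finite exponential sum whose boundary values
lie in the unit balls of the endpoint spaces. -/
lemma exists_exponential_decomposition {p₀ p₁ : Vn n → ℝ} (h₀ : Measurable p₀)
    (h₁ : Measurable p₁) (hp₀ : ∀ x, 1 ≤ p₀ x) (hp₁ : ∀ x, 1 ≤ p₁ x) {θ : ℝ}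
    (hθ : θ ∈ Set.Ioo (0 : ℝ) 1) {f : Vn n → ℂ} (hf : AEStronglyMeasurable f volume)
    (hm : modular (fun x => (θ / p₀ x + (1 - θ) / p₁ x)⁻¹) f ≤ 1) {η : ℝ} (hη : 0 < η) :
    ∃ (s : Finset ℤ) (c : ℤ → ℝ) (u : ℤ → Vn n → ℂ) (r₀ r₁ : Vn n → ℂ),
      (∀ k, memVL p₀ (u k)) ∧ (∀ k, memVL p₁ (u k)) ∧
      (∀ z : ℂ, z.re = 1 → modular p₀ (fun x => ∑ k ∈ s, Complex.exp (z * c k) * u k x) ≤ 1) ∧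
      (∀ z : ℂ, z.re = 0 → modular p₁ (fun x => ∑ k ∈ s, Complex.exp (z * c k) * u k x) ≤ 1) ∧
      (∀ x, f x = ∑ k ∈ s, Complex.exp (θ * c k) * u k x + r₀ x + r₁ x) ∧
      AEStronglyMeasurable r₀ volume ∧ AEStronglyMeasurable r₁ volume ∧
      modular p₀ (fun x => η⁻¹ • r₀ x) ≤ 1 ∧ modular p₁ (fun x => η⁻¹ • r₁ x) ≤ 1 := by
  obtain ⟨hθ0, hθ1⟩ := hθ
  have hθ1' : 0 < 1 - θ := by linarith
  set P : Vn n → ℝ := fun x => (θ / p₀ x + (1 - θ) / p₁ x)⁻¹ with hP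
  have hpos₀ : ∀ x, 0 < p₀ x := fun x => zero_lt_one.trans_le (hp₀ x)
  have hpos₁ : ∀ x, 0 < p₁ x := fun x => zero_lt_one.trans_le (hp₁ x)
  have hPm : Measurable P := by fun_prop
  set a : Vn n → ℝ := fun x => Real.log ‖f x‖ * (P x / p₀ x) with ha
  set b : Vn n → ℝ := fun x => Real.log ‖f x‖ * (P x / p₁ x) with hb
  set d : Vn n → ℝ := fun x => a x - b x with hd
  have hfm : AEMeasurable f volume := hf.aemeasurable
  have ham : AEMeasurable a volume := by fun_prop
  have hbm : AEMeasurable b volume := by fun_prop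
  have hdm : AEMeasurable d volume := ham.sub hbm
  have hlog : ∀ x, b x + θ * d x = Real.log ‖f x‖ := by
    intro x
    have h2 : θ / p₀ x + (1 - θ) / p₁ x ≠ 0 := by
      have := hpos₀ x
      have := hpos₁ x
      positivity
    have h3 : P x * (θ / p₀ x + (1 - θ) / p₁ x) = 1 := inv_mul_cancel₀ h2
    calc b x + θ * d x = Real.log ‖f x‖ * (P x * (θ / p₀ x + (1 - θ) / p₁ x)) := by
          simp only [hd, ha, hb]; ring
      _ = _ := by rw [h3, mul_one]
  set sg : Vn n → ℂ := fun x => f x / (‖f x‖ : ℂ) with hsg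
  have hsg1 : ∀ x, ‖sg x‖ ≤ 1 := by
    intro x
    simp only [hsg, norm_div, Complex.norm_real, norm_norm]
    exact div_self_le_one _
  have hsg0 : ∀ x, f x = 0 → sg x = 0 := fun x hx => by simp [hsg, hx]
  have hsgm : AEMeasurable sg volume := by fun_prop
  have hfsg : ∀ x, f x = sg x * (Real.exp (b x + θ * d x) : ℝ) := by
    intro x
    by_cases hx : f x = 0
    · simp [hx, hsg0]
    · rw [hlog, Real.exp_log (norm_pos_iff.2 hx)]
      simp only [hsg]
      rw [div_mul_cancel₀]
      simpa using hx
  obtain ⟨K, hK⟩ : ∃ K : ℕ, Real.exp (-(min θ (1 - θ) * (K * η))) ≤ η := by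
    have hmin : 0 < min θ (1 - θ) * η := mul_pos (lt_min hθ0 hθ1') hη
    obtain ⟨K, hK⟩ := exists_nat_ge (-Real.log η / (min θ (1 - θ) * η))
    refine ⟨K, ?_⟩
    rw [← Real.le_log_iff_exp_le hη]
    rw [div_le_iff₀ hmin] at hK
    linarith
  set κ : Vn n → ℤ := fun x => ⌊d x / η⌋ with hκ
  have hκ1 : ∀ x, κ x * η ≤ d x := fun x => by
    have := Int.floor_le (d x / η)
    rwa [le_div_iff₀ hη] at this
  have hκ2 : ∀ x, d x < κ x * η + η := fun x => by
    have := Int.lt_floor_add_one (d x / η)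
    rw [div_lt_iff₀ hη] at this
    simp only [hκ]
    linarith
  have hκm : AEMeasurable κ volume := Int.measurable_floor.comp_aemeasurable (hdm.div_const η)
  set s : Finset ℤ := Finset.Icc (-(K : ℤ)) K with hs
  set c : ℤ → ℝ := fun k => k * η with hc
  set u : ℤ → Vn n → ℂ := fun k x => if κ x = k then sg x * (Real.exp (b x) : ℝ) else 0 with hu
  have hum : ∀ k, AEStronglyMeasurable (u k) volume := by
    intro k
    have h1 : AEMeasurable (fun x => sg x * (Real.exp (b x) : ℝ)) volume := by fun_prop
    have h2 : AEMeasurable (fun x => if κ x = k then (1 : ℂ) else 0) volume :=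
      (measurable_from_top (f := fun j : ℤ => if j = k then (1 : ℂ) else 0)).comp_aemeasurable hκm
    have h3 : u k = fun x => (if κ x = k then (1 : ℂ) else 0) * (sg x * (Real.exp (b x) : ℝ)) := by
      funext x
      simp only [hu]
      split_ifs <;> simp
    rw [h3]
    exact (h2.mul h1).aestronglyMeasurable
  have hsum : ∀ (z : ℂ) x, ∑ k ∈ s, Complex.exp (z * c k) * u k x =
      if κ x ∈ s then Complex.exp (z * c (κ x)) * (sg x * (Real.exp (b x) : ℝ)) else 0 := by
    intro z x
    simp only [hu, mul_ite, mul_zero, Finset.sum_ite_eq]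
  have hsum0 : ∀ (z : ℂ) x, f x = 0 → ∑ k ∈ s, Complex.exp (z * c k) * u k x = 0 := by
    intro z x hx
    rw [hsum, hsg0 x hx]
    simp
  have hsumle : ∀ (z : ℂ) x, ‖∑ k ∈ s, Complex.exp (z * c k) * u k x‖ ≤
      Real.exp (b x + z.re * (κ x * η)) := by
    intro z x
    rw [hsum]
    split_ifs
    · rw [norm_mul, norm_mul, Complex.norm_exp, Complex.re_mul_ofReal, Complex.norm_real,
        Real.norm_of_nonneg (Real.exp_pos _).le, add_comm, Real.exp_add]
      gcongr
      exact mul_le_of_le_one_left (Real.exp_pos _).le (hsg1 x)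
    · simpa using (Real.exp_pos _).le
  have hule : ∀ k x, ‖u k x‖ ≤ Real.exp (b x) := by
    intro k x
    simp only [hu]
    split_ifs
    · rw [norm_mul, Complex.norm_real, Real.norm_of_nonneg (Real.exp_pos _).le]
      exact mul_le_of_le_one_left (Real.exp_pos _).le (hsg1 x)
    · simpa using (Real.exp_pos _).le
  have hule' : ∀ k x, ‖u k x‖ ≤ Real.exp (-(k * η)) * Real.exp (a x) := by
    intro k x
    by_cases hk : κ x = k
    · refine (hule k x).trans ?_
      rw [← Real.exp_add]
      have := hκ1 x
      rw [hk] at this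
      simp only [hd] at this
      exact Real.exp_le_exp.2 (by linarith)
    · simp only [hu, if_neg hk, norm_zero]
      positivity
  have hu0 : ∀ k x, f x = 0 → u k x = 0 := by
    intro k x hx
    simp [hu, hsg0 x hx]
  set r : Vn n → ℂ := fun x => f x - ∑ k ∈ s, Complex.exp (θ * c k) * u k x with hr
  have hrm : AEMeasurable r volume :=
    hfm.sub (Finset.aemeasurable_fun_sum _ fun k _ => (hum k).aemeasurable.const_mul _)
  have hr0 : ∀ x, f x = 0 → r x = 0 := by
    intro x hx
    simp only [hr]
    rw [hx, hsum0 _ x hx, sub_zero]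
  have hrle : ∀ x, ‖r x‖ ≤ η * Real.exp (if 0 ≤ d x then a x else b x) := by
    intro x
    have hab : a x = b x + d x := by simp only [hd]; ring
    by_cases hx : κ x ∈ s
    · have h4 : r x =
          sg x * ((Real.exp (b x + θ * d x) - Real.exp (b x + θ * (κ x * η)) : ℝ) : ℂ) := by
        simp only [hr]
        rw [hsum, if_pos hx]
        nth_rewrite 1 [hfsg x]
        rw [Real.exp_add (b x) (θ * (κ x * η))]
        simp only [hc]
        push_cast
        ring
      have h5 : Real.exp (b x + θ * (κ x * η)) =
          Real.exp (b x + θ * d x) * Real.exp (-(θ * (d x - κ x * η))) := by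
        rw [← Real.exp_add]; congr 1; ring
      have h6 := Real.add_one_le_exp (-(θ * (d x - κ x * η)))
      have h7 : θ * (d x - κ x * η) ≤ η := by nlinarith [hκ1 x, hκ2 x]
      have h8 : Real.exp (b x + θ * (κ x * η)) ≤ Real.exp (b x + θ * d x) :=
        Real.exp_le_exp.2 (by nlinarith [hκ1 x])
      calc ‖r x‖ ≤ 1 * (Real.exp (b x + θ * d x) - Real.exp (b x + θ * (κ x * η))) := by
            rw [h4, norm_mul, Complex.norm_real, Real.norm_of_nonneg (by linarith)]
            exact mul_le_mul_of_nonneg_right (hsg1 x) (by linarith)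
        _ ≤ η * Real.exp (b x + θ * d x) := by
            rw [h5]
            nlinarith [Real.exp_pos (b x + θ * d x)]
        _ ≤ _ := by
            gcongr
            split_ifs with h <;> nlinarith
    · have h4 : ‖r x‖ ≤ Real.exp (b x + θ * d x) := by
        simp only [hr]
        rw [hsum, if_neg hx, sub_zero]
        nth_rewrite 1 [hfsg x]
        rw [norm_mul, Complex.norm_real, Real.norm_of_nonneg (Real.exp_pos _).le]
        exact mul_le_of_le_one_left (Real.exp_pos _).le (hsg1 x)
      refine h4.trans (le_trans ?_ (mul_le_mul_of_nonneg_right hK (Real.exp_pos _).le))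
      rw [← Real.exp_add]
      refine Real.exp_le_exp.2 ?_
      have hKη : 0 ≤ K * η := by positivity
      rw [hs, Finset.mem_Icc, not_and_or, not_le, not_le] at hx
      split_ifs with h
      · have h9 : K * η ≤ d x := by
          rcases hx with hx | hx
          · have h10 : (κ x : ℝ) + 1 ≤ -K := by exact_mod_cast hx
            nlinarith [hκ2 x]
          · have h10 : (K : ℝ) ≤ κ x := by exact_mod_cast hx.le
            nlinarith [hκ1 x]
        have h11 : min θ (1 - θ) * (K * η) ≤ (1 - θ) * d x :=
          mul_le_mul (min_le_right _ _) h9 hKη hθ1'.le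
        linarith
      · have h9 : K * η ≤ -d x := by
          rcases hx with hx | hx
          · have h10 : (κ x : ℝ) + 1 ≤ -K := by exact_mod_cast hx
            nlinarith [hκ2 x]
          · have h10 : (K : ℝ) ≤ κ x := by exact_mod_cast hx.le
            nlinarith [hκ1 x]
        have h11 : min θ (1 - θ) * (K * η) ≤ θ * (-d x) :=
          mul_le_mul (min_le_left _ _) h9 hKη hθ0.le
        linarith
  have hind : AEMeasurable (fun x => if 0 ≤ d x then (1 : ℂ) else 0) volume :=
    (Measurable.ite measurableSet_Ici measurable_const measurable_const :
      Measurable fun t : ℝ => if 0 ≤ t then (1 : ℂ) else 0).comp_aemeasurable hdm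
  refine ⟨s, c, u, fun x => (if 0 ≤ d x then (1 : ℂ) else 0) * r x,
    fun x => (1 - if 0 ≤ d x then (1 : ℂ) else 0) * r x, fun k => ⟨hum k, Real.exp (-(k * η)),
    Real.exp_pos _, ?_⟩, fun k => ⟨hum k, 1, one_pos, ?_⟩, fun z hz => ?_, fun z hz => ?_,
    fun x => ?_, (hind.mul hrm).aestronglyMeasurable,
    ((hind.const_sub 1).mul hrm).aestronglyMeasurable, ?_, ?_⟩
  · refine ((modular_le_of_norm_le_exp hp₀ (f := f) (q := P) (fun x hx => ?_) fun x => ?_).trans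
      hm).trans_lt one_lt_top
    · simp [hu0 k x hx]
    · rw [norm_smul, Real.norm_of_nonneg (by positivity), inv_mul_le_iff₀ (Real.exp_pos _)]
      exact hule' k x
  · refine ((modular_le_of_norm_le_exp hp₁ (f := f) (q := P) (fun x hx => ?_) fun x => ?_).trans
      hm).trans_lt one_lt_top
    · simp [hu0 k x hx]
    · simpa using hule k x
  · refine (modular_le_of_norm_le_exp hp₀ (f := f) (q := P) (hsum0 z) fun x => ?_).trans hm
    refine (hsumle z x).trans (Real.exp_le_exp.2 ?_)
    have := hκ1 x
    simp only [hd, ha] at this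
    rw [hz]
    linarith
  · refine (modular_le_of_norm_le_exp hp₁ (f := f) (q := P) (hsum0 z) fun x => ?_).trans hm
    refine (hsumle z x).trans_eq ?_
    rw [hz, zero_mul, add_zero]
  · simp only [hr]
    ring
  · refine (modular_le_of_norm_le_exp hp₀ (f := f) (q := P) (fun x hx => ?_) fun x => ?_).trans hm
    · simp [hr0 x hx]
    · rw [norm_smul, Real.norm_of_nonneg (by positivity), inv_mul_le_iff₀ hη]
      have := hrle x
      beta_reduce
      split_ifs at this ⊢
      · simpa using this
      · rw [zero_mul, norm_zero]
        positivity
  · refine (modular_le_of_norm_le_exp hp₁ (f := f) (q := P) (fun x hx => ?_) fun x => ?_).trans hm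
    · simp [hr0 x hx]
    · rw [norm_smul, Real.norm_of_nonneg (by positivity), inv_mul_le_iff₀ hη]
      have := hrle x
      beta_reduce
      split_ifs at this ⊢
      · rw [sub_self, zero_mul, norm_zero]
        positivity
      · simpa using this

end Decomposition

section Interpolation

variable {n : ℕ}

lemma modular_inv_smul_apply_le_one {p : Vn n → ℝ} (hp : ∀ x, 1 ≤ p x)
    {T : (Vn n → ℂ) → (Vn n → ℂ)} {M M' : ℝ} (hM : 0 ≤ M) (hMM' : M < M')
    (hb : ∀ f, memVL p f → memVL p (T f) ∧ VLnorm p (T f) ≤ ENNReal.ofReal M * VLnorm p f)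
    {u : Vn n → ℂ} (hu : AEStronglyMeasurable u volume) {c : ℝ} (hc : 0 < c)
    (hm : modular p (fun x => c⁻¹ • u x) ≤ 1) :
    memVL p (T u) ∧ modular p (fun x => (M' * c)⁻¹ • T u x) ≤ 1 := by
  obtain ⟨h1, h2⟩ := hb u ⟨hu, c, hc, hm.trans_lt one_lt_top⟩
  refine ⟨h1, modular_inv_smul_le_one_of_VLnorm_lt hp (h2.trans_lt ?_)⟩
  calc ENNReal.ofReal M * VLnorm p u ≤ ENNReal.ofReal M * ENNReal.ofReal c := by
        gcongr
        exact VLnorm_le_ofReal hc hm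
    _ = ENNReal.ofReal (M * c) := (ENNReal.ofReal_mul hM).symm
    _ < ENNReal.ofReal (M' * c) := by
        have : 0 < M' := hM.trans_lt hMM'
        rw [ENNReal.ofReal_lt_ofReal_iff (by positivity)]
        gcongr

lemma one_le_interp_exponent {q₀ q₁ θ : ℝ} (hq₀ : 1 ≤ q₀) (hq₁ : 1 ≤ q₁)
    (hθ : θ ∈ Set.Ioo (0 : ℝ) 1) : 1 ≤ (θ / q₀ + (1 - θ) / q₁)⁻¹ := by
  have h0 := hθ.1
  have h1 : 0 < 1 - θ := by linarith [hθ.2]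
  refine (one_le_inv₀ (by positivity)).2 ?_
  linarith [div_le_self h0.le hq₀, div_le_self h1.le hq₁]

/-- The interpolation estimate on the unit ball of the intermediate space. -/
lemma modular_interp_apply_le_one {p₀ p₁ : Vn n → ℝ} (h₀ : Measurable p₀) (h₁ : Measurable p₁)
    (hp₀ : ∀ x, 1 ≤ p₀ x) (hp₁ : ∀ x, 1 ≤ p₁ x) {θ : ℝ} (hθ : θ ∈ Set.Ioo (0 : ℝ) 1)
    (T : (Vn n → ℂ) →ₗ[ℂ] (Vn n → ℂ)) {M₀ M₁ N₀ N₁ : ℝ} (hM₀ : 0 ≤ M₀) (hM₁ : 0 ≤ M₁)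
    (hN₀ : M₀ < N₀) (hN₁ : M₁ < N₁)
    (hb₀ : ∀ f, memVL p₀ f → memVL p₀ (T f) ∧ VLnorm p₀ (T f) ≤ ENNReal.ofReal M₀ * VLnorm p₀ f)
    (hb₁ : ∀ f, memVL p₁ f → memVL p₁ (T f) ∧ VLnorm p₁ (T f) ≤ ENNReal.ofReal M₁ * VLnorm p₁ f)
    {f : Vn n → ℂ} (hf : AEStronglyMeasurable f volume)
    (hm : modular (fun x => (θ / p₀ x + (1 - θ) / p₁ x)⁻¹) f ≤ 1) :
    AEStronglyMeasurable (T f) volume ∧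
      modular (fun x => (θ / p₀ x + (1 - θ) / p₁ x)⁻¹)
        (fun x => (4 * (N₀ ^ θ * N₁ ^ (1 - θ)))⁻¹ • T f x) ≤ 1 := by
  have hN₀' : 0 < N₀ := hM₀.trans_lt hN₀
  have hN₁' : 0 < N₁ := hM₁.trans_lt hN₁
  have hTsum : ∀ (s : Finset ℤ) (a : ℤ → ℂ) (u : ℤ → Vn n → ℂ),
      T (fun x => ∑ k ∈ s, a k * u k x) = fun x => ∑ k ∈ s, a k * T (u k) x := by
    intro s a u
    have h1 : (fun x => ∑ k ∈ s, a k * u k x) = ∑ k ∈ s, a k • u k := by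
      funext x; simp [Finset.sum_apply]
    rw [h1, map_sum]
    funext x
    simp [Finset.sum_apply]
  have hTdec : ∀ (s : Finset ℤ) (a : ℤ → ℂ) (u : ℤ → Vn n → ℂ) (r₀ r₁ : Vn n → ℂ),
      (∀ x, f x = ∑ k ∈ s, a k * u k x + r₀ x + r₁ x) →
      ∀ x, T f x = ∑ k ∈ s, a k * T (u k) x + T r₀ x + T r₁ x := by
    intro s a u r₀ r₁ h x
    have h1 : f = (fun x => ∑ k ∈ s, a k * u k x) + r₀ + r₁ := funext h
    rw [h1, map_add, map_add, hTsum]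
    rfl
  have hTf : AEStronglyMeasurable (T f) volume := by
    obtain ⟨s, c, u, r₀, r₁, hu₀, -, -, -, hdec, hr₀, hr₁, hmr₀, hmr₁⟩ :=
      exists_exponential_decomposition h₀ h₁ hp₀ hp₁ hθ hf hm one_pos
    rw [funext (hTdec s _ u r₀ r₁ hdec)]
    refine ((Finset.aestronglyMeasurable_fun_sum _ fun k _ => ?_).add ?_).add ?_
    · exact (hb₀ _ (hu₀ k)).1.1.const_mul _
    · exact (modular_inv_smul_apply_le_one hp₀ hM₀ hN₀ hb₀ hr₀ one_pos hmr₀).1.1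
    · exact (modular_inv_smul_apply_le_one hp₁ hM₁ hN₁ hb₁ hr₁ one_pos hmr₁).1.1
  refine ⟨hTf, ?_⟩
  set M := N₀ ^ θ * N₁ ^ (1 - θ) with hM
  have hMpos : 0 < M := by positivity
  set e : Vn n → ℝ := fun x => θ / p₀ x + (1 - θ) / p₁ x with he
  have hepos : ∀ x, 0 < e x := fun x => by
    have h2 := zero_lt_one.trans_le (hp₀ x)
    have h3 := zero_lt_one.trans_le (hp₁ x)
    have h4 : 0 < 1 - θ := by linarith [hθ.2]
    have h5 := hθ.1
    simp only [he]
    positivity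
  have hele : ∀ x, e x ≤ 1 := fun x => by
    have h2 := div_le_self hθ.1.le (hp₀ x)
    have h3 := div_le_self (a := 1 - θ) (by linarith [hθ.2]) (hp₁ x)
    simp only [he]
    linarith
  have hem : Measurable e := by fun_prop
  set h := hTf.mk (T f) with hh
  have hhm : Measurable h := hTf.stronglyMeasurable_mk.measurable
  have hheq : T f =ᵐ[volume] h := hTf.ae_eq_mk
  set w : Vn n → ℝ := fun x => ‖(4 * M)⁻¹ • h x‖ ^ (e x)⁻¹ with hw
  have hwm : Measurable w := by fun_prop
  have hw0 : ∀ x, 0 ≤ w x := fun x => Real.rpow_nonneg (norm_nonneg _) _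
  have hmod : modular (fun x => (e x)⁻¹) (fun x => (4 * M)⁻¹ • T f x) =
      ∫⁻ x, ENNReal.ofReal (w x) := by
    refine lintegral_congr_ae ?_
    filter_upwards [hheq] with x hx
    simp only [hx, hw]
  rw [hmod]
  set S : ℕ → Set (Vn n) := fun N =>
    {x | ‖x‖ ≤ N} ∩ ({x | 0 < w x} ∩ {x | |Real.log (w x)| ≤ N}) with hS
  have hSm : ∀ N, MeasurableSet (S N) := fun N =>
    (measurableSet_le measurable_norm measurable_const).inter
      ((measurableSet_lt measurable_const hwm).inter
        (measurableSet_le (by fun_prop) measurable_const))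
  have hSmono : Monotone S := by
    intro N N' hNN x hx
    have hc : (N : ℝ) ≤ N' := by exact_mod_cast hNN
    exact ⟨hx.1.trans hc, hx.2.1, hx.2.2.trans hc⟩
  have hSfin : ∀ N, volume (S N) ≠ ⊤ := fun N =>
    ne_top_of_le_ne_top (measure_closedBall_lt_top (x := (0 : Vn n)) (r := N)).ne
      (measure_mono fun x hx => by simpa using hx.1)
  have hSunion : ∀ x, w x ≠ 0 → x ∈ ⋃ N, S N := by
    intro x hx
    obtain ⟨N, hN⟩ := exists_nat_ge (max ‖x‖ |Real.log (w x)|)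
    exact Set.mem_iUnion.2 ⟨N, (le_max_left _ _).trans hN, (hw0 x).lt_of_ne' hx,
      (le_max_right _ _).trans hN⟩
  have hsupp : ∫⁻ x, ENNReal.ofReal (w x) = ∫⁻ x in ⋃ N, S N, ENNReal.ofReal (w x) := by
    rw [← lintegral_indicator (MeasurableSet.iUnion hSm)]
    refine lintegral_congr fun x => ?_
    by_cases hx : w x = 0
    · rw [Set.indicator_apply_eq_zero.2 fun _ => by rw [hx, ENNReal.ofReal_zero], hx,
        ENNReal.ofReal_zero]
    · rw [Set.indicator_of_mem (hSunion x hx)]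
  rw [hsupp, setLIntegral_iUnion_of_directed _ hSmono.directed_le]
  refine iSup_le fun N => ?_
  have hSw : ∀ x ∈ S N, 0 < w x := fun x hx => hx.2.1
  have hSL : ∀ x ∈ S N, |Real.log (w x)| ≤ N := fun x hx => hx.2.2
  have hWtop := setLIntegral_ofReal_ne_top (hSm N) (hSfin N) hSw hSL
  set W := ∫⁻ x in S N, ENNReal.ofReal (w x) with hW
  set τ : Vn n → ℂ := fun x => (starRingEnd ℂ) (h x) / (‖h x‖ : ℂ) with hτ
  have hτm : Measurable τ :=
    (Complex.continuous_conj.measurable.comp hhm).div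
      (Complex.measurable_ofReal.comp hhm.norm)
  have hτ1 : ∀ x, ‖τ x‖ ≤ 1 := fun x => by
    simp only [hτ, norm_div, Complex.norm_real, norm_norm, RCLike.norm_conj]
    exact div_self_le_one _
  set g : Vn n → ℂ := fun x => τ x * ((w x ^ (1 - e x) : ℝ) : ℂ) with hg
  have hgm : Measurable g := hτm.mul (Complex.measurable_ofReal.comp (by fun_prop))
  have hgle : ∀ x ∈ S N, ‖g x‖ ≤ Real.exp N := by
    intro x hx
    simp only [hg]
    rw [norm_mul, Complex.norm_real, Real.norm_of_nonneg (Real.rpow_nonneg (hw0 x) _),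
      ← one_mul (Real.exp N)]
    refine mul_le_mul (hτ1 x) ?_ (Real.rpow_nonneg (hw0 x) _) zero_le_one
    rw [Real.rpow_def_of_pos (hSw x hx)]
    refine Real.exp_le_exp.2 ?_
    have h5 := (le_abs_self _).trans (hSL x hx)
    have h6 := hepos x
    have h7 := hele x
    have h8 : (0 : ℝ) ≤ N := N.cast_nonneg
    calc Real.log (w x) * (1 - e x) ≤ N * (1 - e x) := by gcongr
      _ ≤ N := by nlinarith
  have hhg : ∀ x ∈ S N, h x * g x = ((4 * M * w x : ℝ) : ℂ) := by
    intro x hx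
    have hwx := hSw x hx
    have hhx : h x ≠ 0 := by
      intro h0
      simp only [hw, h0, smul_zero, norm_zero] at hwx
      rw [Real.zero_rpow (inv_pos.2 (hepos x)).ne'] at hwx
      exact lt_irrefl _ hwx
    have h5 : h x * τ x = (‖h x‖ : ℂ) := by
      simp only [hτ]
      rw [mul_div_assoc', Complex.mul_conj']
      have : (‖h x‖ : ℂ) ≠ 0 := by simpa using hhx
      field_simp
    have h6 : ‖h x‖ = 4 * M * w x ^ e x := by
      simp only [hw]
      rw [← Real.rpow_mul (norm_nonneg _), inv_mul_cancel₀ (hepos x).ne', Real.rpow_one,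
        norm_smul, Real.norm_of_nonneg (by positivity)]
      field_simp
    simp only [hg]
    rw [← mul_assoc, h5, h6, ← Complex.ofReal_mul]
    congr 1
    rw [mul_assoc, ← Real.rpow_add hwx]
    simp
  have hpair : ‖∫ x in S N, T f x * g x‖ = 4 * M * W.toReal := by
    have h5 : ∫ x in S N, T f x * g x = ∫ x in S N, ((4 * M * w x : ℝ) : ℂ) := by
      refine setIntegral_congr_ae (hSm N) ?_
      filter_upwards [hheq] with x hx hxS
      rw [hx, hhg x hxS]
    rw [h5, integral_complex_ofReal, integral_const_mul, Complex.norm_real,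
      integral_eq_lintegral_of_nonneg_ae (Eventually.of_forall hw0) hwm.aestronglyMeasurable,
      Real.norm_of_nonneg (by positivity)]
  have hest : ∀ η : ℝ, 0 < η → 4 * M * W.toReal ≤ M * (1 + W.toReal) +
      η * ((N₀ + N₁) * (1 + (volume (S N)).toReal) * Real.exp N) := by
    intro η hη
    obtain ⟨s, c, u, r₀, r₁, hu₀, hu₁, hz₀, hz₁, hdec, hr₀, hr₁, hmr₀, hmr₁⟩ :=
      exists_exponential_decomposition h₀ h₁ hp₀ hp₁ hθ hf hm hη
    obtain ⟨hTr₀, hTr₀'⟩ := modular_inv_smul_apply_le_one hp₀ hM₀ hN₀ hb₀ hr₀ hη hmr₀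
    obtain ⟨hTr₁, hTr₁'⟩ := modular_inv_smul_apply_le_one hp₁ hM₁ hN₁ hb₁ hr₁ hη hmr₁
    have hTu : ∀ k ∈ s, IntegrableOn (T (u k)) (S N) := fun k _ =>
      (hb₀ _ (hu₀ k)).1.integrableOn hp₀ (hSm N) (hSfin N)
    have hmul : ∀ {H : Vn n → ℂ}, IntegrableOn H (S N) →
        IntegrableOn (fun x => H x * g x) (S N) := fun hH =>
      hH.mul_bdd hgm.aestronglyMeasurable ((ae_restrict_mem (hSm N)).mono hgle)
    have hum : ∀ z : ℂ, AEStronglyMeasurable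
        (fun x => ∑ k ∈ s, Complex.exp (z * c k) * u k x) volume := fun z =>
      Finset.aestronglyMeasurable_fun_sum _ fun k _ => (hu₀ k).1.const_mul _
    have hmain : ‖∫ x in S N, (∑ k ∈ s, Complex.exp (θ * c k) * T (u k) x) * g x‖ ≤
        M * (1 + W.toReal) := by
      refine norm_setIntegral_interp_le h₀ h₁ hp₀ hp₁ ⟨hθ.1.le, hθ.2.le⟩ (hSm N) (hSfin N) hwm hSw
        hSL hτm hτ1 s c hTu hN₀' hN₁' (fun z hz => ?_) fun z hz => ?_
      · have := (modular_inv_smul_apply_le_one hp₀ hM₀ hN₀ hb₀ (hum z) one_pos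
          (by simpa using hz₀ z hz)).2
        rwa [hTsum, mul_one] at this
      · have := (modular_inv_smul_apply_le_one hp₁ hM₁ hN₁ hb₁ (hum z) one_pos
          (by simpa using hz₁ z hz)).2
        rwa [hTsum, mul_one] at this
    have he₀ := norm_setIntegral_mul_le_of_norm_le hp₀ (by positivity) hTr₀' (hSm N) (hSfin N)
      (Real.exp_pos N).le hgle
    have he₁ := norm_setIntegral_mul_le_of_norm_le hp₁ (by positivity) hTr₁' (hSm N) (hSfin N)
      (Real.exp_pos N).le hgle
    have hsumint : IntegrableOn (fun x => ∑ k ∈ s, Complex.exp (θ * c k) * T (u k) x) (S N) :=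
      integrable_finsetSum _ fun k hk => (hTu k hk).const_mul _
    have hi₀ := hmul (hTr₀.integrableOn hp₀ (hSm N) (hSfin N))
    have hi₁ := hmul (hTr₁.integrableOn hp₁ (hSm N) (hSfin N))
    have hsplit : ∫ x in S N, T f x * g x =
        (∫ x in S N, (∑ k ∈ s, Complex.exp (θ * c k) * T (u k) x) * g x) +
          (∫ x in S N, T r₀ x * g x) + ∫ x in S N, T r₁ x * g x := by
      have hi₂ : IntegrableOn (fun x => (∑ k ∈ s, Complex.exp (θ * c k) * T (u k) x) * g x +
          T r₀ x * g x) (S N) := (hmul hsumint).add hi₀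
      rw [← integral_add (hmul hsumint) hi₀, ← integral_add hi₂ hi₁]
      congr 1
      funext x
      rw [hTdec s _ u r₀ r₁ hdec x]
      ring
    rw [← hpair, hsplit]
    refine (norm_add₃_le).trans ?_
    linarith
  have hlim : 4 * M * W.toReal ≤ M * (1 + W.toReal) := by
    set C := (N₀ + N₁) * (1 + (volume (S N)).toReal) * Real.exp N with hC
    have hCpos : 0 < C := by positivity
    refine le_of_forall_pos_le_add fun δ hδ => ?_
    have := hest (δ / C) (by positivity)
    rwa [div_mul_cancel₀ _ hCpos.ne'] at this
  have hW1 : W.toReal ≤ 1 := by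
    by_contra! hcon
    nlinarith
  rw [← ENNReal.ofReal_toReal hWtop]
  exact ENNReal.ofReal_le_one.2 hW1

lemma interp_apply_of_lt {p₀ p₁ : Vn n → ℝ} (h₀ : Measurable p₀) (h₁ : Measurable p₁)
    (hp₀ : ∀ x, 1 ≤ p₀ x) (hp₁ : ∀ x, 1 ≤ p₁ x) {θ : ℝ} (hθ : θ ∈ Set.Ioo (0 : ℝ) 1)
    (T : (Vn n → ℂ) →ₗ[ℂ] (Vn n → ℂ)) {M₀ M₁ N₀ N₁ : ℝ} (hM₀ : 0 ≤ M₀) (hM₁ : 0 ≤ M₁)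
    (hN₀ : M₀ < N₀) (hN₁ : M₁ < N₁)
    (hb₀ : ∀ f, memVL p₀ f → memVL p₀ (T f) ∧ VLnorm p₀ (T f) ≤ ENNReal.ofReal M₀ * VLnorm p₀ f)
    (hb₁ : ∀ f, memVL p₁ f → memVL p₁ (T f) ∧ VLnorm p₁ (T f) ≤ ENNReal.ofReal M₁ * VLnorm p₁ f)
    {f : Vn n → ℂ} (hf : memVL (fun x => (θ / p₀ x + (1 - θ) / p₁ x)⁻¹) f) :
    memVL (fun x => (θ / p₀ x + (1 - θ) / p₁ x)⁻¹) (T f) ∧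
      VLnorm (fun x => (θ / p₀ x + (1 - θ) / p₁ x)⁻¹) (T f) ≤
        ENNReal.ofReal (4 * N₀ ^ θ * N₁ ^ (1 - θ)) *
          VLnorm (fun x => (θ / p₀ x + (1 - θ) / p₁ x)⁻¹) f := by
  have hN₀' : 0 < N₀ := hM₀.trans_lt hN₀
  have hN₁' : 0 < N₁ := hM₁.trans_lt hN₁
  set M := 4 * (N₀ ^ θ * N₁ ^ (1 - θ)) with hM
  have hMpos : 0 < M := by positivity
  have hM' : 4 * N₀ ^ θ * N₁ ^ (1 - θ) = M := mul_assoc _ _ _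
  set P : Vn n → ℝ := fun x => (θ / p₀ x + (1 - θ) / p₁ x)⁻¹ with hP
  have hP1 : ∀ x, 1 ≤ P x := fun x => one_le_interp_exponent (hp₀ x) (hp₁ x) hθ
  have hstep : ∀ l : ℝ, 0 < l → modular P (fun x => l⁻¹ • f x) ≤ 1 →
      AEStronglyMeasurable (T f) volume ∧ modular P (fun x => (M * l)⁻¹ • T f x) ≤ 1 := by
    intro l hl hml
    have hT : T (fun x => l⁻¹ • f x) = fun x => l⁻¹ • T f x := by
      have h2 : (fun x => l⁻¹ • f x) = ((l⁻¹ : ℝ) : ℂ) • f := by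
        funext x; simp
      rw [h2, map_smul]
      funext x
      simp
    obtain ⟨hmeas, hmod⟩ := modular_interp_apply_le_one h₀ h₁ hp₀ hp₁ hθ T hM₀ hM₁ hN₀ hN₁ hb₀ hb₁
      (hf.1.const_smul l⁻¹) hml
    rw [show (l⁻¹ • f) = fun x => l⁻¹ • f x from rfl, hT] at hmeas hmod
    refine ⟨?_, ?_⟩
    · have := hmeas.const_smul l
      convert this using 1
      funext x
      simp [hl.ne']
    · simp only [mul_inv M l, mul_smul M⁻¹]
      exact hmod
  rw [hM']
  refine ⟨?_, ?_⟩
  · obtain ⟨l, hl, hml⟩ := exists_modular_inv_smul_le_one hP1 hf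
    obtain ⟨h2, h3⟩ := hstep l hl hml
    exact ⟨h2, M * l, by positivity, h3.trans_lt one_lt_top⟩
  · rw [VLnorm.eq_1 P f]
    simp only [ENNReal.mul_iInf_of_ne (ENNReal.ofReal_pos.2 hMpos).ne' ENNReal.ofReal_ne_top]
    refine le_iInf fun l => le_iInf fun hl => le_iInf fun hml => ?_
    rw [← ENNReal.ofReal_mul hMpos.le]
    exact VLnorm_le_ofReal (by positivity) (hstep l hl hml).2

lemma interp_apply {p₀ p₁ : Vn n → ℝ} (h₀ : Measurable p₀) (h₁ : Measurable p₁)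
    (hp₀ : ∀ x, 1 ≤ p₀ x) (hp₁ : ∀ x, 1 ≤ p₁ x) {θ : ℝ} (hθ : θ ∈ Set.Ioo (0 : ℝ) 1)
    (T : (Vn n → ℂ) →ₗ[ℂ] (Vn n → ℂ)) {M₀ M₁ : ℝ} (hM₀ : 0 ≤ M₀) (hM₁ : 0 ≤ M₁)
    (hb₀ : ∀ f, memVL p₀ f → memVL p₀ (T f) ∧ VLnorm p₀ (T f) ≤ ENNReal.ofReal M₀ * VLnorm p₀ f)
    (hb₁ : ∀ f, memVL p₁ f → memVL p₁ (T f) ∧ VLnorm p₁ (T f) ≤ ENNReal.ofReal M₁ * VLnorm p₁ f)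
    {f : Vn n → ℂ} (hf : memVL (fun x => (θ / p₀ x + (1 - θ) / p₁ x)⁻¹) f) :
    memVL (fun x => (θ / p₀ x + (1 - θ) / p₁ x)⁻¹) (T f) ∧
      VLnorm (fun x => (θ / p₀ x + (1 - θ) / p₁ x)⁻¹) (T f) ≤
        ENNReal.ofReal (4 * M₀ ^ θ * M₁ ^ (1 - θ)) *
          VLnorm (fun x => (θ / p₀ x + (1 - θ) / p₁ x)⁻¹) f := by
  have hlt : ∀ δ : ℝ, 0 < δ → _ := fun δ hδ => interp_apply_of_lt h₀ h₁ hp₀ hp₁ hθ T hM₀ hM₁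
    (lt_add_of_pos_right M₀ hδ) (lt_add_of_pos_right M₁ hδ) hb₀ hb₁ hf
  refine ⟨(hlt 1 one_pos).1, ?_⟩
  have hP1 : ∀ x, 1 ≤ (θ / p₀ x + (1 - θ) / p₁ x)⁻¹ := fun x =>
    one_le_interp_exponent (hp₀ x) (hp₁ x) hθ
  have hfin : VLnorm (fun x => (θ / p₀ x + (1 - θ) / p₁ x)⁻¹) f ≠ ⊤ := by
    obtain ⟨l, hl, hml⟩ := exists_modular_inv_smul_le_one hP1 hf
    exact ne_top_of_le_ne_top ENNReal.ofReal_ne_top (VLnorm_le_ofReal hl hml)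
  have hcont : Tendsto (fun δ : ℝ => ENNReal.ofReal (4 * (M₀ + δ) ^ θ * (M₁ + δ) ^ (1 - θ)) *
      VLnorm (fun x => (θ / p₀ x + (1 - θ) / p₁ x)⁻¹) f) (𝓝[>] 0)
      (𝓝 (ENNReal.ofReal (4 * M₀ ^ θ * M₁ ^ (1 - θ)) *
        VLnorm (fun x => (θ / p₀ x + (1 - θ) / p₁ x)⁻¹) f)) := by
    refine ENNReal.Tendsto.mul_const (ENNReal.tendsto_ofReal ?_) (Or.inr hfin)
    have h2 : Continuous fun δ : ℝ => 4 * (M₀ + δ) ^ θ * (M₁ + δ) ^ (1 - θ) :=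
      (continuous_const.mul ((continuous_const.add continuous_id).rpow_const
        fun _ => Or.inr hθ.1.le)).mul ((continuous_const.add continuous_id).rpow_const
          fun _ => Or.inr (by linarith [hθ.2]))
    simpa using (h2.tendsto 0).mono_left nhdsWithin_le_nhds
  exact ge_of_tendsto hcont (eventually_mem_nhdsWithin.mono fun δ hδ => (hlt δ hδ).2)

end Interpolation

/-- Riesz–Thorin-type interpolation for variable Lebesgue spaces, with constant `4`. -/
theorem stmt15 {n : ℕ} (p₀ p₁ : Vn n → ℝ) (h₀ : Measurable p₀) (h₁ : Measurable p₁)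
    (hp₀ : ∀ᵐ x ∂volume, 1 ≤ p₀ x) (hp₁ : ∀ᵐ x ∂volume, 1 ≤ p₁ x)
    (θ : ℝ) (hθ : θ ∈ Set.Icc (0:ℝ) 1)
    (A : (Vn n → ℂ) → (Vn n → ℂ))
    (hadd : ∀ f g, A (f + g) = A f + A g)
    (hsmul : ∀ (c : ℂ) (f), A (c • f) = c • A f)
    (M₀ M₁ : ℝ) (hM₀ : 0 ≤ M₀) (hM₁ : 0 ≤ M₁)
    (hb₀ : ∀ f, memVL p₀ f → memVL p₀ (A f) ∧
      VLnorm p₀ (A f) ≤ ENNReal.ofReal M₀ * VLnorm p₀ f)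
    (hb₁ : ∀ f, memVL p₁ f → memVL p₁ (A f) ∧
      VLnorm p₁ (A f) ≤ ENNReal.ofReal M₁ * VLnorm p₁ f) :
    ∀ f, memVL (fun x => (θ / p₀ x + (1 - θ) / p₁ x)⁻¹) f →
      memVL (fun x => (θ / p₀ x + (1 - θ) / p₁ x)⁻¹) (A f) ∧
      VLnorm (fun x => (θ / p₀ x + (1 - θ) / p₁ x)⁻¹) (A f) ≤
        ENNReal.ofReal (4 * M₀ ^ θ * M₁ ^ (1 - θ)) *
          VLnorm (fun x => (θ / p₀ x + (1 - θ) / p₁ x)⁻¹) f := by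
  intro f hf
  rcases hθ.1.eq_or_lt with rfl | hθ0
  · simp only [zero_div, zero_add, sub_zero, one_div, inv_inv, Real.rpow_zero, Real.rpow_one,
      mul_one] at hf ⊢
    refine ⟨(hb₁ f hf).1, (hb₁ f hf).2.trans ?_⟩
    gcongr
    linarith
  rcases hθ.2.eq_or_lt with rfl | hθ1
  · simp only [sub_self, zero_div, add_zero, one_div, inv_inv, Real.rpow_zero, Real.rpow_one,
      mul_one] at hf ⊢
    refine ⟨(hb₀ f hf).1, (hb₀ f hf).2.trans ?_⟩
    gcongr
    linarith
  have e₀ : p₀ =ᵐ[volume] fun x => max (p₀ x) 1 := by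
    filter_upwards [hp₀] with x hx
    rw [max_eq_left hx]
  have e₁ : p₁ =ᵐ[volume] fun x => max (p₁ x) 1 := by
    filter_upwards [hp₁] with x hx
    rw [max_eq_left hx]
  have eθ : (fun x => (θ / p₀ x + (1 - θ) / p₁ x)⁻¹) =ᵐ[volume]
      fun x => (θ / max (p₀ x) 1 + (1 - θ) / max (p₁ x) 1)⁻¹ := by
    filter_upwards [e₀, e₁] with x hx₀ hx₁
    rw [← hx₀, ← hx₁]
  simp only [memVL_congr_exponent e₀, VLnorm_congr_exponent e₀] at hb₀
  simp only [memVL_congr_exponent e₁, VLnorm_congr_exponent e₁] at hb₁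
  simp only [memVL_congr_exponent eθ, VLnorm_congr_exponent eθ] at hf ⊢
  exact interp_apply (h₀.max measurable_const) (h₁.max measurable_const)
    (fun _ => le_max_right _ _) (fun _ => le_max_right _ _) ⟨hθ0, hθ1⟩
    { toFun := A, map_add' := hadd, map_smul' := hsmul } hM₀ hM₁ hb₀ hb₁ hf
end
end

section
/- Let p : ℝⁿ → [1,∞] be an essentially bounded measurable function. Then C₀^∞(ℝⁿ), the space of smooth compactly supported functions, is dense in the variable Lebesgue space L^{p(·)}(ℝⁿ). -/
open MeasureTheory ENNReal Filter Topology
noncomputable section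
lemma aemeasurable_modular_integrand {n : ℕ} {E : Type*} [NormedAddCommGroup E] {p : Vn n → ℝ}
    (hp : Measurable p) {u : Vn n → E} (hu : AEStronglyMeasurable u volume) :
    AEMeasurable (fun x => ENNReal.ofReal (‖u x‖ ^ p x)) volume :=
  (hu.norm.aemeasurable.pow hp.aemeasurable).ennreal_ofReal

/-- Dominated convergence for the modular. -/
lemma tendsto_modular_zero {n : ℕ} {E F : Type*} [NormedAddCommGroup E] [NormedAddCommGroup F]
    {p : Vn n → ℝ} (hp : Measurable p) (hp1 : ∀ᵐ x ∂volume, 1 ≤ p x)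
    {u : ℕ → Vn n → E} {U : Vn n → F}
    (hu : ∀ j, AEStronglyMeasurable (u j) volume) (hU : modular p U < ⊤)
    (hle : ∀ j x, ‖u j x‖ ≤ ‖U x‖)
    (hlim : ∀ᵐ x ∂volume, Tendsto (fun j => u j x) atTop (𝓝 0)) :
    Tendsto (fun j => modular p (u j)) atTop (𝓝 0) := by
  have h := tendsto_lintegral_of_dominated_convergence' (μ := volume) (f := fun _ : Vn n => 0)
    (F := fun j x => ENNReal.ofReal (‖u j x‖ ^ p x))
    (fun x => ENNReal.ofReal (‖U x‖ ^ p x)) (fun j => aemeasurable_modular_integrand hp (hu j))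
    (fun j => by
      filter_upwards [hp1] with x hx
      have := hle j x
      gcongr) hU.ne (by
      filter_upwards [hp1, hlim] with x hx hl
      have h0 : Tendsto (fun j => ‖u j x‖ ^ p x) atTop (𝓝 0) := by
        have := hl.norm.rpow_const (p := p x) (Or.inr (by linarith))
        rwa [norm_zero, Real.zero_rpow (by linarith)] at this
      simpa using ENNReal.tendsto_ofReal h0)
  simpa [modular] using h

lemma modular_add_le {n : ℕ} {E : Type*} [NormedAddCommGroup E] {p : Vn n → ℝ}
    (hp : Measurable p) (hp1 : ∀ᵐ x ∂volume, 1 ≤ p x) {B : ℝ} (hpB : ∀ᵐ x ∂volume, p x ≤ B)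
    {u v : Vn n → E} (hu : AEStronglyMeasurable u volume) :
    modular p (fun x => u x + v x) ≤ ENNReal.ofReal (2 ^ B) * (modular p u + modular p v) := by
  unfold modular
  rw [← lintegral_add_left' (aemeasurable_modular_integrand hp hu),
    ← lintegral_const_mul' _ _ ENNReal.ofReal_ne_top]
  refine lintegral_mono_ae ?_
  filter_upwards [hp1, hpB] with x h1 hB
  rw [← ENNReal.ofReal_add (by positivity) (by positivity), ← ENNReal.ofReal_mul (by positivity)]
  refine ENNReal.ofReal_le_ofReal ?_
  calc ‖u x + v x‖ ^ p x ≤ (2 * max ‖u x‖ ‖v x‖) ^ p x := by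
        gcongr
        linarith [norm_add_le (u x) (v x), le_max_left ‖u x‖ ‖v x‖, le_max_right ‖u x‖ ‖v x‖]
    _ = 2 ^ p x * (max ‖u x‖ ‖v x‖) ^ p x :=
        Real.mul_rpow zero_le_two (le_max_of_le_left (norm_nonneg _))
    _ ≤ 2 ^ B * (‖u x‖ ^ p x + ‖v x‖ ^ p x) := by
        have h2 : (max ‖u x‖ ‖v x‖) ^ p x ≤ ‖u x‖ ^ p x + ‖v x‖ ^ p x := by
          have hu0 : 0 ≤ ‖u x‖ ^ p x := by positivity
          have hv0 : 0 ≤ ‖v x‖ ^ p x := by positivity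
          rcases max_choice ‖u x‖ ‖v x‖ with h | h <;> rw [h] <;> linarith
        gcongr
        norm_num

lemma modular_smul_lt_top {n : ℕ} {E : Type*} [NormedAddCommGroup E] [NormedSpace ℝ E]
    {p : Vn n → ℝ} (hp1 : ∀ᵐ x ∂volume, 1 ≤ p x) {B : ℝ} (hpB : ∀ᵐ x ∂volume, p x ≤ B)
    {u : Vn n → E} (hu : modular p u < ⊤) (c : ℝ) : modular p (fun x => c • u x) < ⊤ := by
  have : modular p (fun x => c • u x) ≤ ENNReal.ofReal ((max 1 |c|) ^ B) * modular p u := by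
    unfold modular
    rw [← lintegral_const_mul' _ _ ENNReal.ofReal_ne_top]
    refine lintegral_mono_ae ?_
    filter_upwards [hp1, hpB] with x h1 hB
    rw [← ENNReal.ofReal_mul (by positivity), norm_smul, Real.norm_eq_abs,
      Real.mul_rpow (abs_nonneg _) (norm_nonneg _)]
    gcongr
    calc |c| ^ p x ≤ (max 1 |c|) ^ p x := by gcongr; exact le_max_right _ _
      _ ≤ (max 1 |c|) ^ B := Real.rpow_le_rpow_of_exponent_le (le_max_left _ _) hB
  exact this.trans_lt (ENNReal.mul_lt_top ENNReal.ofReal_lt_top hu)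

lemma modular_indicator_const_lt_top {n : ℕ} {p : Vn n → ℝ} (hp1 : ∀ᵐ x ∂volume, 1 ≤ p x)
    {B : ℝ} (hpB : ∀ᵐ x ∂volume, p x ≤ B) {s : Set (Vn n)} (hs : MeasurableSet s)
    (hsv : volume s < ⊤) (c : ℝ) : modular p (fun x => c • s.indicator (1 : Vn n → ℝ) x) < ⊤ := by
  refine modular_smul_lt_top hp1 hpB ?_ c
  have : modular p (s.indicator (1 : Vn n → ℝ)) = ∫⁻ x, s.indicator 1 x := by
    refine lintegral_congr_ae ?_
    filter_upwards [hp1] with x h1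
    by_cases hx : x ∈ s
    · simp [hx]
    · simp [hx, Real.zero_rpow (by linarith : p x ≠ 0)]
  rwa [this, lintegral_indicator_one hs]

/-- Bounded functions vanishing off a ball are approximated in modular by `C₀^∞` functions. -/
lemma exists_contDiff_modular_sub_lt {n : ℕ} {E : Type*} [NormedAddCommGroup E] [NormedSpace ℝ E]
    [CompleteSpace E] {p : Vn n → ℝ} (hp : Measurable p) (hp1 : ∀ᵐ x ∂volume, 1 ≤ p x)
    {B : ℝ} (hpB : ∀ᵐ x ∂volume, p x ≤ B) {f : Vn n → E} (hf : AEStronglyMeasurable f volume)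
    {k : ℝ} (hk : 0 ≤ k) (hfk : ∀ x, ‖f x‖ ≤ k) (hsupp : ∀ x, k < ‖x‖ → f x = 0)
    {δ : ℝ≥0∞} (hδ : 0 < δ) :
    ∃ g : Vn n → E, ContDiff ℝ (⊤ : ℕ∞) g ∧ HasCompactSupport g ∧
      modular p (fun x => f x - g x) < δ := by
  have hcs : HasCompactSupport f :=
    HasCompactSupport.intro (isCompact_closedBall (0 : Vn n) k) fun x hx =>
      hsupp x (by simpa using hx)
  have hint : Integrable f volume := by
    have h : IntegrableOn f (Metric.closedBall (0 : Vn n) k) volume :=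
      Measure.integrableOn_of_bounded (M := k) measure_closedBall_lt_top.ne hf
        (Eventually.of_forall hfk)
    refine (integrableOn_iff_integrable_of_support_subset fun x hx => ?_).1 h
    by_contra hx'
    exact hx (hsupp x (by simpa using hx'))
  let φ : ℕ → ContDiffBump (0 : Vn n) := fun j =>
    ⟨1 / ((j : ℝ) + 1) / 2, 1 / ((j : ℝ) + 1), by positivity, half_lt_self (by positivity)⟩
  have hφ : Tendsto (fun j => (φ j).rOut) atTop (𝓝 0) := tendsto_one_div_add_atTop_nhds_zero_nat
  have hφ1 : ∀ j, (φ j).rOut ≤ 1 := fun j => by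
    change 1 / ((j : ℝ) + 1) ≤ 1
    rw [div_le_one (by positivity)]
    linarith [(Nat.cast_nonneg j : (0 : ℝ) ≤ j)]
  let g : ℕ → Vn n → E := fun j =>
    convolution ((φ j).normed volume) f (ContinuousLinearMap.lsmul ℝ ℝ) volume
  have hgsmooth : ∀ j, ContDiff ℝ (⊤ : ℕ∞) (g j) := fun j =>
    (φ j).hasCompactSupport_normed.contDiff_convolution_left _ (φ j).contDiff_normed
      hint.locallyIntegrable
  have hgsupp : ∀ j, HasCompactSupport (g j) := fun j =>
    (φ j).hasCompactSupport_normed.convolution _ hcs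
  have hgle : ∀ j x, ‖g j x‖ ≤ k := fun j x => by
    simpa using dist_convolution_le (z₀ := (0 : E)) (x₀ := x) hk
      (φ j).support_normed_eq.subset (φ j).nonneg_normed (φ j).integral_normed hf
      (fun y _ => by simpa using hfk y)
  have hgz : ∀ j x, k + 1 < ‖x‖ → g j x = 0 := fun j x hx => by
    have h := dist_convolution_le (z₀ := (0 : E)) (x₀ := x) le_rfl
      (φ j).support_normed_eq.subset (φ j).nonneg_normed (φ j).integral_normed hf
      (fun y hy => by
        have hy' : dist y x < (φ j).rOut := hy
        rw [dist_eq_norm, norm_sub_rev] at hy'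
        rw [hsupp y (by linarith [hφ1 j, norm_sub_norm_le x y]), dist_self])
    simpa using h
  have hlim := ContDiffBump.ae_convolution_tendsto_right_of_locallyIntegrable (μ := volume)
    (φ := φ) (K := 2) hφ (Eventually.of_forall fun j => by
      change 1 / ((j : ℝ) + 1) ≤ 2 * (1 / ((j : ℝ) + 1) / 2)
      linarith) hint.locallyIntegrable
  have hmod := tendsto_modular_zero hp hp1 (u := fun j x => f x - g j x)
    (fun j => hf.sub (hgsmooth j).continuous.aestronglyMeasurable)
    (modular_indicator_const_lt_top hp1 hpB
      (Metric.isClosed_closedBall (x := (0 : Vn n)) (ε := k + 1)).measurableSet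
      measure_closedBall_lt_top (k + k))
    (fun j x => by
      by_cases hx : k + 1 < ‖x‖
      · simpa [hgz j x hx, hsupp x (by linarith)] using by positivity
      · have hx' : x ∈ Metric.closedBall (0 : Vn n) (k + 1) := by simpa using hx
        have h := (norm_sub_le (f x) (g j x)).trans (add_le_add (hfk x) (hgle j x))
        simpa [hx', abs_of_nonneg (add_nonneg hk hk)] using h)
    (by
      filter_upwards [hlim] with x hx
      simpa using (tendsto_const_nhds (x := f x)).sub hx)
  obtain ⟨j, hj⟩ := (hmod.eventually_lt_const hδ).exists
  exact ⟨g j, hgsmooth j, hgsupp j, hj⟩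

/-- Functions of finite modular are approximated in modular by bounded functions vanishing off a
ball. -/
lemma exists_bounded_modular_sub_lt {n : ℕ} {E : Type*} [NormedAddCommGroup E]
    {p : Vn n → ℝ} (hp : Measurable p) (hp1 : ∀ᵐ x ∂volume, 1 ≤ p x)
    {f : Vn n → E} (hf : AEStronglyMeasurable f volume) (hfin : modular p f < ⊤)
    {δ : ℝ≥0∞} (hδ : 0 < δ) :
    ∃ (h : Vn n → E) (k : ℝ), AEStronglyMeasurable h volume ∧ 0 ≤ k ∧ (∀ x, ‖h x‖ ≤ k) ∧
      (∀ x, k < ‖x‖ → h x = 0) ∧ modular p (fun x => f x - h x) < δ := by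
  let s : ℕ → Set (Vn n) := fun k => {x | ‖x‖ ≤ k} ∩ {x | ‖f x‖ ≤ k}
  have hs : ∀ k, NullMeasurableSet (s k) volume := fun k =>
    (measurableSet_le measurable_norm measurable_const).nullMeasurableSet.inter
      (nullMeasurableSet_le hf.norm.aemeasurable aemeasurable_const)
  have hh : ∀ k, AEStronglyMeasurable ((s k).indicator f) volume := fun k => hf.indicator₀ (hs k)
  have hmod := tendsto_modular_zero hp hp1 (u := fun k x => f x - (s k).indicator f x)
    (fun k => hf.sub (hh k)) hfin
    (fun k x => by by_cases hx : x ∈ s k <;> simp [hx])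
    (Eventually.of_forall fun x => by
      obtain ⟨N, hN⟩ := exists_nat_ge (max ‖x‖ ‖f x‖)
      refine tendsto_const_nhds.congr' ?_
      filter_upwards [eventually_ge_atTop N] with k hk
      have hNk : (N : ℝ) ≤ k := by exact_mod_cast hk
      have hx : x ∈ s k :=
        ⟨(le_max_left _ _).trans (hN.trans hNk), (le_max_right _ _).trans (hN.trans hNk)⟩
      simp [hx])
  obtain ⟨k, hk⟩ := (hmod.eventually_lt_const hδ).exists
  refine ⟨(s k).indicator f, k, hh k, Nat.cast_nonneg k, fun x => ?_, fun x hx => ?_, hk⟩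
  · by_cases hx : x ∈ s k
    · simpa [hx] using hx.2
    · simp [hx]
  · exact Set.indicator_of_notMem (fun h => hx.not_ge h.1) f

/-- Density of `C₀^∞(ℝⁿ)` in `L^{p(·)}(ℝⁿ)` for essentially bounded `p`. -/
theorem stmt16 {n : ℕ} (p : Vn n → ℝ) (hp : Measurable p)
    (hp1 : ∀ᵐ x ∂volume, 1 ≤ p x) (B : ℝ) (hpB : ∀ᵐ x ∂volume, p x ≤ B) :
    ∀ f : Vn n → ℂ, memVL p f → ∀ ε : ℝ, 0 < ε →
      ∃ g : Vn n → ℂ, ContDiff ℝ (⊤ : ℕ∞) g ∧ HasCompactSupport g ∧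
        VLnorm p (f - g) ≤ ENNReal.ofReal ε := by
  rintro f ⟨hf, l, hl, hfin⟩ ε hε
  have hfε : AEStronglyMeasurable (fun x => ε⁻¹ • f x) volume := hf.const_smul ε⁻¹
  have hfinε : modular p (fun x => ε⁻¹ • f x) < ⊤ := by
    have h := modular_smul_lt_top hp1 hpB hfin (ε⁻¹ * l)
    simpa only [smul_smul, mul_assoc, mul_inv_cancel₀ hl.ne', mul_one] using h
  have hC0 : ENNReal.ofReal (2 ^ B) ≠ 0 := by
    rw [Ne, ENNReal.ofReal_eq_zero, not_le]
    positivity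
  let δ : ℝ≥0∞ := (ENNReal.ofReal (2 ^ B))⁻¹ / 2
  have hδ : 0 < δ :=
    ENNReal.div_pos (ENNReal.inv_ne_zero.2 ENNReal.ofReal_ne_top) ENNReal.ofNat_ne_top
  obtain ⟨h, k, hh, hk, hhk, hhz, hfh⟩ := exists_bounded_modular_sub_lt hp hp1 hfε hfinε hδ
  obtain ⟨g, hg, hgs, hhg⟩ := exists_contDiff_modular_sub_lt hp hp1 hpB hh hk hhk hhz hδ
  refine ⟨ε • g, contDiff_const.smul hg, hgs.smul_left (f := fun _ => ε), ?_⟩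
  refine iInf_le_of_le ε (iInf_le_of_le hε (iInf_le_of_le ?_ le_rfl))
  have hadd := modular_add_le hp hp1 hpB (v := fun x => h x - g x) (hfε.sub hh)
  have heq : (fun x => ε⁻¹ • (f - ε • g) x) =
      fun x => ((fun x => ε⁻¹ • f x) - h) x + (h x - g x) := by
    funext x
    simp only [Pi.sub_apply, Pi.smul_apply, smul_sub, smul_smul, inv_mul_cancel₀ hε.ne', one_smul]
    abel
  rw [heq]
  calc _ ≤ _ := hadd
    _ ≤ ENNReal.ofReal (2 ^ B) * (δ + δ) := by gcongr; exact hfh.le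
    _ = 1 := by
      rw [ENNReal.add_halves, ENNReal.mul_inv_cancel hC0 ENNReal.ofReal_ne_top]
end
end
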